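/- Suppose E[d¹Δ | σ(x)] = e¹(x)·(xᵀβ¹* + κ(x)) and E[d⁰Δ | σ(x)] = e⁰(x)·(xᵀβ⁰* + κ(x)) almost surely, for some β¹*, β⁰* ∈ ℝ^p and a measurable function κ : ℝ^p → ℝ (the outcome-change model (9) of the paper). Then E[ρΔ | σ(x)] = xᵀ(β¹* − β⁰*) almost surely; consequently, if E[‖x‖²] < ∞ and M := E[e¹(x)·x·xᵀ] is invertible, the population least-squares coefficient M⁻¹·E[e¹(x)·E[ρΔ | σ(x)]·x] equals β¹* − β⁰*. -/

import Mathlib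

open MeasureTheory ProbabilityTheory Matrix

/-- Under the outcome-change model (9) of the paper,
`E[ρΔ | σ(x)] = xᵀ(β¹* − β⁰*)` almost surely, and consequently the population
least-squares coefficient `M⁻¹ E[e¹(x) E[ρΔ|σ(x)] x]` equals `β¹* − β⁰*`. -/
theorem outcome_model_identifies_att_coefficient
    {Ω : Type*} [MeasurableSpace Ω] (μ : Measure Ω) [IsProbabilityMeasure μ]
    {p : ℕ} (hp : 1 ≤ p)
    (x : Ω → Fin p → ℝ) (hx : Measurable x)
    (d1 : Ω → ℝ) (hd1 : Measurable d1) (hd1b : ∀ ω, d1 ω = 0 ∨ d1 ω = 1)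
    (Δ : Ω → ℝ) (hΔ : Measurable Δ) (hΔint : Integrable Δ μ)
    (e1 : (Fin p → ℝ) → ℝ) (he1 : Measurable e1)
    (he1ver : (fun ω => e1 (x ω)) =ᵐ[μ]
      μ[d1 | MeasurableSpace.comap x inferInstance])
    (ε0 : ℝ) (hε0 : 0 < ε0)
    (hpos : ∀ᵐ ω ∂μ, ε0 < e1 (x ω) ∧ e1 (x ω) < 1 - ε0)
    (ρ : Ω → ℝ)
    (hρ : ∀ ω, ρ ω = d1 ω / e1 (x ω) - (1 - d1 ω) / (1 - e1 (x ω)))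
    (β1 β0 : Fin p → ℝ) (κ : (Fin p → ℝ) → ℝ) (hκ : Measurable κ)
    -- the outcome-change model (9)
    (hlin1 : μ[fun ω => d1 ω * Δ ω | MeasurableSpace.comap x inferInstance]
      =ᵐ[μ] fun ω => e1 (x ω) * (x ω ⬝ᵥ β1 + κ (x ω)))
    (hlin0 : μ[fun ω => (1 - d1 ω) * Δ ω | MeasurableSpace.comap x inferInstance]
      =ᵐ[μ] fun ω => (1 - e1 (x ω)) * (x ω ⬝ᵥ β0 + κ (x ω)))
    (hx2 : Integrable (fun ω => ‖x ω‖ ^ 2) μ)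
    (M : Matrix (Fin p) (Fin p) ℝ)
    (hM : M = Matrix.of fun i j => ∫ ω, e1 (x ω) * (x ω i * x ω j) ∂μ)
    (hMinv : IsUnit M.det) :
    (μ[fun ω => ρ ω * Δ ω | MeasurableSpace.comap x inferInstance]
        =ᵐ[μ] fun ω => x ω ⬝ᵥ (β1 - β0)) ∧
      M⁻¹ *ᵥ (fun i => ∫ ω, e1 (x ω) *
          (μ[fun ω' => ρ ω' * Δ ω' | MeasurableSpace.comap x inferInstance]) ω *
          x ω i ∂μ) = β1 - β0 := by
  have hm : MeasurableSpace.comap x inferInstance ≤ (inferInstance : MeasurableSpace Ω) :=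
    hx.comap_le
  have hxm : Measurable[MeasurableSpace.comap x inferInstance] x := comap_measurable x
  have key : ∀ (w : (Fin p → ℝ) → ℝ) (g : Ω → ℝ), Measurable w →
      (∀ᵐ ω ∂μ, ‖w (x ω)‖ ≤ ε0⁻¹) → Integrable g μ →
      Integrable ((fun ω => w (x ω)) * g) μ ∧
      μ[(fun ω => w (x ω)) * g | MeasurableSpace.comap x inferInstance] =ᵐ[μ]
        (fun ω => w (x ω)) * μ[g | MeasurableSpace.comap x inferInstance] := by
    intro w g hw hb hg
    have hi : Integrable ((fun ω => w (x ω)) * g) μ :=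
      hg.bdd_mul (hw.comp hx).aestronglyMeasurable hb
    exact ⟨hi, condExp_mul_of_stronglyMeasurable_left
      (hw.comp hxm).stronglyMeasurable hi hg⟩
  have hd1n : ∀ ω, ‖d1 ω‖ ≤ 1 := by
    intro ω; rcases hd1b ω with h | h <;> simp [h]
  have hd0n : ∀ ω, ‖1 - d1 ω‖ ≤ 1 := by
    intro ω; rcases hd1b ω with h | h <;> simp [h]
  have hi1 : Integrable (fun ω => d1 ω * Δ ω) μ :=
    hΔint.bdd_mul hd1.aestronglyMeasurable (Filter.Eventually.of_forall hd1n)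
  have hi0 : Integrable (fun ω => (1 - d1 ω) * Δ ω) μ :=
    hΔint.bdd_mul (measurable_const.sub hd1).aestronglyMeasurable
      (Filter.Eventually.of_forall hd0n)
  obtain ⟨k1, k1'⟩ := key (fun y => (e1 y)⁻¹) _ he1.inv (by
    filter_upwards [hpos] with ω h
    rw [norm_inv, Real.norm_of_nonneg (by linarith)]
    exact inv_anti₀ hε0 h.1.le) hi1
  obtain ⟨k0, k0'⟩ := key (fun y => (1 - e1 y)⁻¹) _ (measurable_const.sub he1).inv (by
    filter_upwards [hpos] with ω h
    rw [norm_inv, Real.norm_of_nonneg (by linarith)]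
    exact inv_anti₀ hε0 (by linarith)) hi0
  have hfun : (fun ω => ρ ω * Δ ω) = ((fun ω => (e1 (x ω))⁻¹) * fun ω => d1 ω * Δ ω)
      - ((fun ω => (1 - e1 (x ω))⁻¹) * fun ω => (1 - d1 ω) * Δ ω) := by
    funext ω
    simp only [Pi.sub_apply, Pi.mul_apply, hρ, div_eq_mul_inv]
    ring
  have part1 : μ[fun ω => ρ ω * Δ ω | MeasurableSpace.comap x inferInstance]
        =ᵐ[μ] fun ω => x ω ⬝ᵥ (β1 - β0) := by
    rw [hfun]
    filter_upwards [condExp_sub k1 k0 (MeasurableSpace.comap x inferInstance),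
      k1', k0', hlin1, hlin0, hpos] with ω h h1 h0 l1 l0 hp
    rw [h, Pi.sub_apply, h1, h0, Pi.mul_apply, Pi.mul_apply, l1, l0,
      inv_mul_cancel_left₀ (by linarith), inv_mul_cancel_left₀ (by linarith), dotProduct_sub]
    ring
  refine ⟨part1, ?_⟩
  have hint : ∀ i j, Integrable (fun ω => e1 (x ω) * (x ω i * x ω j)) μ := by
    intro i j
    have hij : Integrable (fun ω => x ω i * x ω j) μ := by
      refine hx2.mono' (((measurable_pi_apply i).comp hx).mul
        ((measurable_pi_apply j).comp hx)).aestronglyMeasurable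
        (Filter.Eventually.of_forall fun ω => ?_)
      rw [norm_mul, sq]
      exact mul_le_mul (norm_le_pi_norm _ _) (norm_le_pi_norm _ _) (norm_nonneg _)
        (norm_nonneg _)
    refine hij.bdd_mul (c := 1) (he1.comp hx).aestronglyMeasurable ?_
    filter_upwards [hpos] with ω h
    rw [Real.norm_of_nonneg (by linarith)]
    linarith
  have hvec : (fun i => ∫ ω, e1 (x ω) *
          (μ[fun ω' => ρ ω' * Δ ω' | MeasurableSpace.comap x inferInstance]) ω *
          x ω i ∂μ) = M *ᵥ (β1 - β0) := by
    funext i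
    have h1 : ∫ ω, e1 (x ω) *
          (μ[fun ω' => ρ ω' * Δ ω' | MeasurableSpace.comap x inferInstance]) ω *
          x ω i ∂μ = ∫ ω, ∑ j, e1 (x ω) * (x ω i * x ω j) * (β1 - β0) j ∂μ := by
      refine integral_congr_ae ?_
      filter_upwards [part1] with ω h
      rw [h, dotProduct, Finset.mul_sum, Finset.sum_mul]
      exact Finset.sum_congr rfl fun j _ => by ring
    rw [h1, integral_finsetSum _ fun j _ => (hint i j).mul_const _, hM]
    simp only [mulVec, dotProduct, of_apply, integral_mul_const]
  rw [hvec, mulVec_mulVec, nonsing_inv_mul _ hMinv, one_mulVec]
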